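/- arXiv:2601.19031 — 5 statements merged into one kernel-verified Lean document; each statement's English description precedes it below -/
import Mathlib

section
/- For every κ ∈ (0,1) there exists a unique ζ ∈ (0,1) satisfying the Rayleigh wave equation (2 − ζ)² = 4·√(1 − ζ)·√(1 − κ²ζ), where the square roots are the real square roots. -/
/-- On `(0, 1)` the Rayleigh equation is equivalent to a cubic equation in `ζ`. -/
theorem rayleigh_equation_iff_cubic {κ ζ : ℝ} (hκ : κ ∈ Set.Ioo (0 : ℝ) 1)
    (hζ : ζ ∈ Set.Ioo (0 : ℝ) 1) :
    (2 - ζ) ^ 2 = 4 * Real.sqrt (1 - ζ) * Real.sqrt (1 - κ ^ 2 * ζ) ↔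
      ζ ^ 3 - 8 * ζ ^ 2 + (24 - 16 * κ ^ 2) * ζ - 16 * (1 - κ ^ 2) = 0 := by
  obtain ⟨hκ0, hκ1⟩ := hκ
  obtain ⟨hζ0, hζ1⟩ := hζ
  have hκ2 : κ ^ 2 < 1 := by nlinarith
  have hs : Real.sqrt (1 - ζ) ^ 2 = 1 - ζ := Real.sq_sqrt (by linarith)
  have ht : Real.sqrt (1 - κ ^ 2 * ζ) ^ 2 = 1 - κ ^ 2 * ζ := Real.sq_sqrt (by nlinarith)
  rw [← sq_eq_sq₀ (by positivity) (by positivity), mul_pow, mul_pow, hs, ht, ← sub_eq_zero]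
  have hfactor : ((2 - ζ) ^ 2) ^ 2 - 4 ^ 2 * (1 - ζ) * (1 - κ ^ 2 * ζ) =
      ζ * (ζ ^ 3 - 8 * ζ ^ 2 + (24 - 16 * κ ^ 2) * ζ - 16 * (1 - κ ^ 2)) := by ring
  rw [hfactor, mul_eq_zero, or_iff_right hζ0.ne']

/-- The Rayleigh cubic has at most one root below `1`. -/
theorem rayleigh_cubic_root_unique {k x y : ℝ} (hx : x < 1) (hy : y < 1)
    (hpx : x ^ 3 - 8 * x ^ 2 + (24 - 16 * k) * x - 16 * (1 - k) = 0)
    (hpy : y ^ 3 - 8 * y ^ 2 + (24 - 16 * k) * y - 16 * (1 - k) = 0) : x = y := by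
  have hprod : (x - y) * (1 + (1 - x) * (1 - y) * (5 + (1 - x) + (1 - y))) = 0 := by
    linear_combination (1 - y) * hpx - (1 - x) * hpy
  have hx' : 0 < 1 - x := sub_pos.2 hx
  have hy' : 0 < 1 - y := sub_pos.2 hy
  exact sub_eq_zero.1 ((mul_eq_zero.1 hprod).resolve_right (by positivity))

theorem rayleigh_equation_unique_root
    (κ : ℝ) (hκ : κ ∈ Set.Ioo (0 : ℝ) 1) :
    ∃! ζ : ℝ, ζ ∈ Set.Ioo (0 : ℝ) 1 ∧
      (2 - ζ) ^ 2 = 4 * Real.sqrt (1 - ζ) * Real.sqrt (1 - κ ^ 2 * ζ) := by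
  have hκ2 : κ ^ 2 < 1 := by nlinarith [hκ.1, hκ.2]
  have hcont : ContinuousOn
      (fun ζ : ℝ ↦ ζ ^ 3 - 8 * ζ ^ 2 + (24 - 16 * κ ^ 2) * ζ - 16 * (1 - κ ^ 2))
      (Set.Icc 0 1) := by fun_prop
  obtain ⟨ζ, hζ, hroot⟩ := intermediate_value_Ioo zero_le_one hcont
    (show (0 : ℝ) ∈ Set.Ioo _ _ by constructor <;> linarith)
  refine ⟨ζ, ⟨hζ, (rayleigh_equation_iff_cubic hκ hζ).2 hroot⟩, ?_⟩
  rintro y ⟨hy, hyeq⟩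
  exact rayleigh_cubic_root_unique hy.2 hζ.2 ((rayleigh_equation_iff_cubic hκ hy).1 hyeq) hroot
end

section
/- Fix wavenumbers 0 < k_L < k_T. With Ω(ξ) = (2ξ² − k_T²)² − 4ξ²√(ξ² − k_T²)·√(ξ² − k_L²) defined using real square roots for ξ ≥ k_T, the ξ⁴ terms cancel and the remainder is bounded: there exists a constant C such that for all ξ ≥ 2k_T, |Ω(ξ) − 2(k_L² − k_T²)ξ²| ≤ C. -/
/-- The geometric mean of `x - a` and `x - b` differs from their arithmetic mean by `O(1 / x)`. -/
lemma arith_sub_geom_mean_bound {a b x : ℝ} (hb : 0 ≤ b) (hba : b ≤ a) (hx : 4 * a ≤ x) :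
    0 ≤ x * (x - (a + b) / 2 - √(x - a) * √(x - b)) ∧
      x * (x - (a + b) / 2 - √(x - a) * √(x - b)) ≤ (a - b) ^ 2 / 2 := by
  set S := √(x - a) * √(x - b) with hS
  have hS0 : 0 ≤ S := by positivity
  have hSsq : S ^ 2 = (x - a) * (x - b) := by
    rw [hS, mul_pow, Real.sq_sqrt (by linarith), Real.sq_sqrt (by linarith)]
  have hle : S ≤ x - (a + b) / 2 :=
    abs_le_of_sq_le_sq' (by nlinarith [sq_nonneg (a - b)]) (by linarith) |>.2
  have hprod : (x - (a + b) / 2 - S) * (x - (a + b) / 2 + S) = (a - b) ^ 2 / 4 := by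
    linear_combination -hSsq
  have hmul : (x - (a + b) / 2 - S) * (x / 2) ≤
      (x - (a + b) / 2 - S) * (x - (a + b) / 2 + S) :=
    mul_le_mul_of_nonneg_left (by linarith) (by linarith)
  exact ⟨mul_nonneg (by linarith) (by linarith), by linarith⟩

theorem rayleigh_denominator_asymptotics
    (kL kT : ℝ) (hkL : 0 < kL) (hkT : kL < kT) :
    ∃ C : ℝ, ∀ ξ : ℝ, 2 * kT ≤ ξ →
      |((2 * ξ ^ 2 - kT ^ 2) ^ 2
          - 4 * ξ ^ 2 * Real.sqrt (ξ ^ 2 - kT ^ 2) * Real.sqrt (ξ ^ 2 - kL ^ 2))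
        - 2 * (kL ^ 2 - kT ^ 2) * ξ ^ 2| ≤ C := by
  refine ⟨(kT ^ 2) ^ 2 + 2 * (kT ^ 2 - kL ^ 2) ^ 2, fun ξ hξ => ?_⟩
  obtain ⟨h₀, h₁⟩ := arith_sub_geom_mean_bound (a := kT ^ 2) (b := kL ^ 2) (x := ξ ^ 2)
    (sq_nonneg _) (by nlinarith) (by nlinarith)
  have ha : 0 ≤ (kT ^ 2) ^ 2 := by positivity
  rw [abs_le]
  constructor <;> linarith [sq_nonneg (kT ^ 2 - kL ^ 2)]
end

section
/- Fix μ > 0 and wavenumbers 0 < k_L < k_T. With Ω(ξ) = (2ξ² − k_T²)² − 4ξ²√(ξ² − k_T²)·√(ξ² − k_L²) and α_HS(ξ) = −√(ξ² − k_L²)·k_T²/(μ·Ω(ξ)) defined using real square roots for ξ ≥ k_T, one has lim_{ξ→∞} ξ·α_HS(ξ) = −k_T²/(2μ(k_L² − k_T²)); in particular α_HS(ξ) = O(ξ^{−1}) as ξ → ∞. -/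
open Filter Asymptotics

/-- The Rayleigh denominator `Ω(ξ)` (real square roots, for `ξ ≥ k_T`). -/
noncomputable def rayleighDenom (kL kT ξ : ℝ) : ℝ :=
  (2 * ξ ^ 2 - kT ^ 2) ^ 2
    - 4 * ξ ^ 2 * Real.sqrt (ξ ^ 2 - kT ^ 2) * Real.sqrt (ξ ^ 2 - kL ^ 2)

/-- The half-space admittance `α_HS(ξ) = −√(ξ²−k_L²)·k_T²/(μ·Ω(ξ))`. -/
noncomputable def alphaHS (μ kL kT ξ : ℝ) : ℝ :=
  -Real.sqrt (ξ ^ 2 - kL ^ 2) * kT ^ 2 / (μ * rayleighDenom kL kT ξ)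

/-- The rescaled denominator `Ω(ξ) / ξ²` as a function of `u = ξ⁻²`, rationalized so that it is
continuous at `u = 0`. -/
noncomputable def scaledRayleighDenom (kL kT u : ℝ) : ℝ :=
  4 * (kT ^ 2 + kL ^ 2 - kT ^ 2 * kL ^ 2 * u)
      / (1 + Real.sqrt (1 - kT ^ 2 * u) * Real.sqrt (1 - kL ^ 2 * u))
    - 4 * kT ^ 2 + kT ^ 4 * u

theorem scaledRayleighDenom_zero (kL kT : ℝ) :
    scaledRayleighDenom kL kT 0 = 2 * (kL ^ 2 - kT ^ 2) := by
  simp only [scaledRayleighDenom, mul_zero, sub_zero, Real.sqrt_one]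
  ring

theorem continuous_scaledRayleighDenom (kL kT : ℝ) :
    Continuous (scaledRayleighDenom kL kT) := by
  unfold scaledRayleighDenom
  have h : ∀ u : ℝ, 1 + Real.sqrt (1 - kT ^ 2 * u) * Real.sqrt (1 - kL ^ 2 * u) ≠ 0 :=
    fun u => by positivity
  fun_prop (disch := exact h)

theorem sqrt_sq_sub_sq_eq_mul_sqrt {ξ : ℝ} (hξ : 0 < ξ) (k : ℝ) :
    Real.sqrt (ξ ^ 2 - k ^ 2) = ξ * Real.sqrt (1 - k ^ 2 * (ξ ^ 2)⁻¹) := by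
  have h : ξ ^ 2 - k ^ 2 = ξ ^ 2 * (1 - k ^ 2 * (ξ ^ 2)⁻¹) := by field_simp
  rw [h, Real.sqrt_mul (sq_nonneg ξ), Real.sqrt_sq hξ.le]

theorem one_sub_sq_mul_inv_sq_nonneg {k ξ : ℝ} (hk : 0 ≤ k) (hkξ : k ≤ ξ) :
    0 ≤ 1 - k ^ 2 * (ξ ^ 2)⁻¹ := by
  rw [sub_nonneg, ← div_eq_mul_inv]
  exact div_le_one_of_le₀ (pow_le_pow_left₀ hk hkξ 2) (sq_nonneg ξ)

theorem rayleighDenom_eq_sq_mul_scaledRayleighDenom {kL kT ξ : ℝ} (hkL : 0 ≤ kL) (hkT : 0 ≤ kT)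
    (hξ : 0 < ξ) (hL : kL ≤ ξ) (hT : kT ≤ ξ) :
    rayleighDenom kL kT ξ = ξ ^ 2 * scaledRayleighDenom kL kT (ξ ^ 2)⁻¹ := by
  have hs := Real.sq_sqrt (one_sub_sq_mul_inv_sq_nonneg hkT hT)
  have hr := Real.sq_sqrt (one_sub_sq_mul_inv_sq_nonneg hkL hL)
  have hs0 := Real.sqrt_nonneg (1 - kT ^ 2 * (ξ ^ 2)⁻¹)
  have hr0 := Real.sqrt_nonneg (1 - kL ^ 2 * (ξ ^ 2)⁻¹)
  rw [rayleighDenom, scaledRayleighDenom, sqrt_sq_sub_sq_eq_mul_sqrt hξ,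
    sqrt_sq_sub_sq_eq_mul_sqrt hξ]
  generalize Real.sqrt (1 - kT ^ 2 * (ξ ^ 2)⁻¹) = s at *
  generalize Real.sqrt (1 - kL ^ 2 * (ξ ^ 2)⁻¹) = r at *
  have hsr : 1 + s * r ≠ 0 := by positivity
  have key : 4 * (kT ^ 2 + kL ^ 2 - kT ^ 2 * kL ^ 2 * (ξ ^ 2)⁻¹) / (1 + s * r)
      = 4 * ξ ^ 2 * (1 - s * r) := by
    rw [div_eq_iff hsr]
    have h : (1 - s * r) * (1 + s * r) = 1 - s ^ 2 * r ^ 2 := by ring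
    rw [mul_assoc _ (1 - s * r), h, hs, hr]
    field_simp
    ring
  rw [key]
  field_simp
  ring

theorem mul_alphaHS_eq (μ : ℝ) {kL kT ξ : ℝ} (hkL : 0 ≤ kL) (hkT : 0 ≤ kT)
    (hξ : 0 < ξ) (hL : kL ≤ ξ) (hT : kT ≤ ξ) :
    ξ * alphaHS μ kL kT ξ
      = -Real.sqrt (1 - kL ^ 2 * (ξ ^ 2)⁻¹) * kT ^ 2
          / (μ * scaledRayleighDenom kL kT (ξ ^ 2)⁻¹) := by
  rw [alphaHS, rayleighDenom_eq_sq_mul_scaledRayleighDenom hkL hkT hξ hL hT,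
    sqrt_sq_sub_sq_eq_mul_sqrt hξ, ← mul_div_assoc,
    ← mul_div_mul_left (-Real.sqrt (1 - kL ^ 2 * (ξ ^ 2)⁻¹) * kT ^ 2) _ (pow_ne_zero 2 hξ.ne')]
  congr 1 <;> ring

theorem alphaHS_asymptotics
    (μ kL kT : ℝ) (hμ : 0 < μ) (hkL : 0 < kL) (hkT : kL < kT) :
    Tendsto (fun ξ : ℝ => ξ * alphaHS μ kL kT ξ) atTop
        (nhds (-kT ^ 2 / (2 * μ * (kL ^ 2 - kT ^ 2))))
    ∧ (fun ξ : ℝ => alphaHS μ kL kT ξ) =O[atTop] (fun ξ : ℝ => ξ⁻¹) := by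
  have hden : μ * scaledRayleighDenom kL kT 0 ≠ 0 := by
    rw [scaledRayleighDenom_zero]
    have : kL ^ 2 - kT ^ 2 < 0 := by nlinarith
    exact mul_ne_zero hμ.ne' (mul_ne_zero two_ne_zero this.ne)
  have hcont : ContinuousAt (fun u : ℝ => -Real.sqrt (1 - kL ^ 2 * u) * kT ^ 2
      / (μ * scaledRayleighDenom kL kT u)) 0 := by
    refine ContinuousAt.div ?_ ?_ hden
    · fun_prop
    · exact (continuous_const.mul (continuous_scaledRayleighDenom kL kT)).continuousAt
  have hu : Tendsto (fun ξ : ℝ => (ξ ^ 2)⁻¹) atTop (nhds 0) :=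
    tendsto_inv_atTop_zero.comp (tendsto_pow_atTop two_ne_zero)
  have hlim : Tendsto (fun ξ : ℝ => ξ * alphaHS μ kL kT ξ) atTop
      (nhds (-kT ^ 2 / (2 * μ * (kL ^ 2 - kT ^ 2)))) := by
    have h := hcont.tendsto.comp hu
    simp only [mul_zero, sub_zero, Real.sqrt_one, scaledRayleighDenom_zero, neg_one_mul] at h
    rw [← mul_assoc, mul_comm μ 2] at h
    refine h.congr' ?_
    filter_upwards [eventually_ge_atTop kT] with ξ hξ
    have hT := hkL.trans hkT
    exact (mul_alphaHS_eq μ hkL.le hT.le (hT.trans_le hξ) (hkT.le.trans hξ) hξ).symm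
  refine ⟨hlim, ?_⟩
  have hO := (isBigO_refl (fun ξ : ℝ => ξ⁻¹) atTop).mul (hlim.isBigO_one ℝ)
  refine hO.congr' ?_ ?_
  · filter_upwards [eventually_gt_atTop 0] with ξ hξ
    exact inv_mul_cancel_left₀ hξ.ne' _
  · simp
end

section
/- Fix μ > 0, C_L > C_T > 0 and ξ > 0. For ω > 0 small enough that ξ > ω/C_T, define k_L(ω) = ω/C_L, k_T(ω) = ω/C_T, Ω(ξ,ω) = (2ξ² − k_T²)² − 4ξ²√(ξ² − k_T²)·√(ξ² − k_L²) and α_HS(ξ,ω) = −√(ξ² − k_L²)·k_T²/(μ·Ω(ξ,ω)) with real square roots. Then lim_{ω→0⁺} α_HS(ξ,ω) = C_L²/(2μξ(C_L² − C_T²)). -/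
open Filter

/-- The Rayleigh denominator, with its factor `ω ^ 2` extracted. Here `a` and `b` are the
reciprocal wave speeds. -/
lemma rayleigh_factorization {ξ a b ω : ℝ} (hξ : 0 < ξ)
    (ha : 0 ≤ ξ ^ 2 - (ω * a) ^ 2) (hb : 0 ≤ ξ ^ 2 - (ω * b) ^ 2) :
    (2 * ξ ^ 2 - (ω * a) ^ 2) ^ 2
        - 4 * ξ ^ 2 * Real.sqrt (ξ ^ 2 - (ω * a) ^ 2) * Real.sqrt (ξ ^ 2 - (ω * b) ^ 2)
      = ω ^ 2 * (-4 * ξ ^ 2 * a ^ 2 + a ^ 4 * ω ^ 2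
          + 4 * ξ ^ 2 * (ξ ^ 2 * (a ^ 2 + b ^ 2) - a ^ 2 * b ^ 2 * ω ^ 2)
            / (ξ ^ 2 + Real.sqrt (ξ ^ 2 - (ω * a) ^ 2) * Real.sqrt (ξ ^ 2 - (ω * b) ^ 2))) := by
  have hP := Real.sq_sqrt ha
  have hQ := Real.sq_sqrt hb
  have hP0 := Real.sqrt_nonneg (ξ ^ 2 - (ω * a) ^ 2)
  have hQ0 := Real.sqrt_nonneg (ξ ^ 2 - (ω * b) ^ 2)
  set P := Real.sqrt (ξ ^ 2 - (ω * a) ^ 2)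
  set Q := Real.sqrt (ξ ^ 2 - (ω * b) ^ 2)
  have hD : ξ ^ 2 + P * Q ≠ 0 := by positivity
  have hPQ : P ^ 2 * Q ^ 2 = (ξ ^ 2 - (ω * a) ^ 2) * (ξ ^ 2 - (ω * b) ^ 2) := by rw [hP, hQ]
  field_simp
  linear_combination -4 * ξ ^ 2 * hPQ

theorem alphaHS_static_limit
    (μ CL CT ξ : ℝ) (hμ : 0 < μ) (hCT : 0 < CT) (hCLT : CT < CL) (hξ : 0 < ξ) :
    Tendsto (fun ω : ℝ =>
        -Real.sqrt (ξ ^ 2 - (ω / CL) ^ 2) * (ω / CT) ^ 2 /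
          (μ * ((2 * ξ ^ 2 - (ω / CT) ^ 2) ^ 2
            - 4 * ξ ^ 2 * Real.sqrt (ξ ^ 2 - (ω / CT) ^ 2)
                * Real.sqrt (ξ ^ 2 - (ω / CL) ^ 2))))
      (nhdsWithin 0 (Set.Ioi 0))
      (nhds (CL ^ 2 / (2 * μ * ξ * (CL ^ 2 - CT ^ 2)))) := by
  have hCL : 0 < CL := hCT.trans hCLT
  have hsub : 0 < CL ^ 2 - CT ^ 2 := by nlinarith
  set a := CT⁻¹ with ha_def
  set b := CL⁻¹ with hb_def
  have ha : 0 < a := inv_pos.mpr hCT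
  have hb : 0 < b := inv_pos.mpr hCL
  have hba : b < a := inv_strictAnti₀ hCT hCLT
  simp only [div_eq_mul_inv _ CT, div_eq_mul_inv _ CL, ← ha_def, ← hb_def]
  let B : ℝ → ℝ := fun ω => -4 * ξ ^ 2 * a ^ 2 + a ^ 4 * ω ^ 2
    + 4 * ξ ^ 2 * (ξ ^ 2 * (a ^ 2 + b ^ 2) - a ^ 2 * b ^ 2 * ω ^ 2)
      / (ξ ^ 2 + Real.sqrt (ξ ^ 2 - (ω * a) ^ 2) * Real.sqrt (ξ ^ 2 - (ω * b) ^ 2))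
  let g : ℝ → ℝ := fun ω => -Real.sqrt (ξ ^ 2 - (ω * b) ^ 2) * a ^ 2 / (μ * B ω)
  have hB0 : B 0 = 2 * ξ ^ 2 * (b ^ 2 - a ^ 2) := by
    simp only [B, zero_mul, ne_eq, OfNat.ofNat_ne_zero, not_false_eq_true, zero_pow, sub_zero,
      Real.sqrt_sq hξ.le]
    field_simp
    ring
  have hB0_ne : B 0 ≠ 0 := by
    rw [hB0]
    exact mul_ne_zero (by positivity) (by nlinarith)
  have hBc : Continuous B := by
    refine .add (by fun_prop) (.div (by fun_prop) (by fun_prop) fun ω => ?_)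
    positivity
  have hg : ContinuousAt g 0 :=
    ContinuousAt.div (by fun_prop) (by fun_prop) (mul_ne_zero hμ.ne' hB0_ne)
  have hg0 : g 0 = CL ^ 2 / (2 * μ * ξ * (CL ^ 2 - CT ^ 2)) := by
    have hab : b ^ 2 - a ^ 2 = -((CL ^ 2 - CT ^ 2) * (a ^ 2 * b ^ 2)) := by
      rw [ha_def, hb_def]
      field_simp
      ring
    have hbL : b ^ 2 * CL ^ 2 = 1 := by
      rw [hb_def]
      field_simp
    have hg_zero : g 0 = -ξ * a ^ 2 / (μ * B 0) := by
      simp [g, Real.sqrt_sq hξ.le]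
    rw [hg_zero, div_eq_div_iff (mul_ne_zero hμ.ne' hB0_ne) (by positivity), hB0, hab]
    linear_combination 2 * μ * ξ ^ 2 * (CL ^ 2 - CT ^ 2) * a ^ 2 * hbL
  rw [← hg0]
  refine (hg.tendsto.mono_left nhdsWithin_le_nhds).congr' ?_
  filter_upwards [Ioo_mem_nhdsGT (div_pos hξ ha)] with ω ⟨hω, hωξ⟩
  have hωa : ω * a < ξ := (lt_div_iff₀ ha).mp hωξ
  have hωb : ω * b < ξ := (mul_lt_mul_of_pos_left hba hω).trans hωa
  have h1 : 0 ≤ ξ ^ 2 - (ω * a) ^ 2 := sub_nonneg.mpr (by gcongr)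
  have h2 : 0 ≤ ξ ^ 2 - (ω * b) ^ 2 := sub_nonneg.mpr (by gcongr)
  rw [rayleigh_factorization hξ h1 h2]
  change -Real.sqrt (ξ ^ 2 - (ω * b) ^ 2) * a ^ 2 / (μ * B ω) =
    -Real.sqrt (ξ ^ 2 - (ω * b) ^ 2) * (ω * a) ^ 2 / (μ * (ω ^ 2 * B ω))
  rw [← mul_div_mul_left _ _ (pow_ne_zero 2 hω.ne')]
  ring_nf
end

section
/- Let R > 0 and ξ > 0. Then ∫₀^R J₀(ξr)²·r dr = (R²/2)·(J₀(Rξ)² + J₁(Rξ)²). -/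
open MeasureTheory

/-- Bessel function of the first kind of order zero (integral representation). -/
noncomputable def besselJ0 (x : ℝ) : ℝ :=
  (1 / Real.pi) * ∫ θ in (0:ℝ)..Real.pi, Real.cos (x * Real.sin θ)

/-- Bessel function of the first kind of order one (integral representation). -/
noncomputable def besselJ1 (x : ℝ) : ℝ :=
  (1 / Real.pi) * ∫ θ in (0:ℝ)..Real.pi, Real.cos (θ - x * Real.sin θ)

theorem hasDerivAt_intervalIntegral_of_bounded {F F' : ℝ → ℝ → ℝ} {a b C : ℝ}
    (hF : ∀ x, Continuous (F x)) (hF' : ∀ x, Continuous (F' x))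
    (hC : ∀ x t, |F' x t| ≤ C)
    (hd : ∀ x t, HasDerivAt (fun y => F y t) (F' x t) x) (x : ℝ) :
    HasDerivAt (fun y => ∫ t in a..b, F y t) (∫ t in a..b, F' x t) x :=
  (intervalIntegral.hasDerivAt_integral_of_dominated_loc_of_deriv_le (bound := fun _ => C)
    Filter.univ_mem (.of_forall fun y => (hF y).aestronglyMeasurable)
    ((hF x).intervalIntegrable _ _) (hF' x).aestronglyMeasurable
    (.of_forall fun t _ y _ => hC y t) intervalIntegrable_const
    (.of_forall fun t _ y _ => hd y t)).2

theorem integral_cos_mul_cos_mul_sin (x : ℝ) :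
    ∫ θ in (0:ℝ)..Real.pi, Real.cos θ * Real.cos (x * Real.sin θ) = 0 := by
  rcases eq_or_ne x 0 with rfl | hx
  · simp
  · have h : ∀ θ ∈ Set.uIcc (0:ℝ) Real.pi,
        HasDerivAt (fun θ => Real.sin (x * Real.sin θ) / x)
          (Real.cos θ * Real.cos (x * Real.sin θ)) θ := fun θ _ => by
      refine ((((Real.hasDerivAt_sin θ).const_mul x).sin).div_const x).congr_deriv ?_
      field_simp
    rw [intervalIntegral.integral_eq_sub_of_hasDerivAt h
      (Continuous.intervalIntegrable (by fun_prop) _ _)]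
    simp

theorem besselJ1_eq_integral_sin_mul_sin (x : ℝ) :
    besselJ1 x
      = (1 / Real.pi) * ∫ θ in (0:ℝ)..Real.pi, Real.sin θ * Real.sin (x * Real.sin θ) := by
  simp only [besselJ1, Real.cos_sub]
  rw [intervalIntegral.integral_add (Continuous.intervalIntegrable (by fun_prop) _ _)
    (Continuous.intervalIntegrable (by fun_prop) _ _), integral_cos_mul_cos_mul_sin, zero_add]

theorem hasDerivAt_besselJ0 (x : ℝ) : HasDerivAt besselJ0 (-besselJ1 x) x := by
  have h := hasDerivAt_intervalIntegral_of_bounded (a := 0) (b := Real.pi) (C := 1)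
    (F := fun y θ => Real.cos (y * Real.sin θ))
    (F' := fun y θ => -(Real.sin θ * Real.sin (y * Real.sin θ)))
    (fun y => by fun_prop) (fun y => by fun_prop)
    (fun y θ => by
      rw [abs_neg, abs_mul]
      exact mul_le_one₀ (Real.abs_sin_le_one _) (abs_nonneg _) (Real.abs_sin_le_one _))
    (fun y θ => (((hasDerivAt_id y).mul_const (Real.sin θ)).cos).congr_deriv
      (by simp only [id]; ring)) x
  refine (h.const_mul (1 / Real.pi)).congr_deriv ?_
  rw [besselJ1_eq_integral_sin_mul_sin, intervalIntegral.integral_neg, mul_neg]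

theorem hasDerivAt_besselJ1 (x : ℝ) :
    HasDerivAt besselJ1
      ((1 / Real.pi) * ∫ θ in (0:ℝ)..Real.pi, Real.sin θ ^ 2 * Real.cos (x * Real.sin θ)) x := by
  have h := hasDerivAt_intervalIntegral_of_bounded (a := 0) (b := Real.pi) (C := 1)
    (F := fun y θ => Real.sin θ * Real.sin (y * Real.sin θ))
    (F' := fun y θ => Real.sin θ ^ 2 * Real.cos (y * Real.sin θ))
    (fun y => by fun_prop) (fun y => by fun_prop)
    (fun y θ => by
      rw [abs_mul, abs_pow]
      exact mul_le_one₀ (pow_le_one₀ (abs_nonneg _) (Real.abs_sin_le_one _)) (abs_nonneg _)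
        (Real.abs_cos_le_one _))
    (fun y θ => ((((hasDerivAt_id y).mul_const (Real.sin θ)).sin).const_mul
      (Real.sin θ)).congr_deriv (by simp only [id]; ring)) x
  rw [funext besselJ1_eq_integral_sin_mul_sin]
  exact h.const_mul (1 / Real.pi)

/-- The recurrence `x J₁'(x) + J₁(x) = x J₀(x)`. -/
theorem mul_deriv_besselJ1_add (x : ℝ) :
    x * deriv besselJ1 x + besselJ1 x = x * besselJ0 x := by
  have h : ∀ θ ∈ Set.uIcc (0:ℝ) Real.pi,
      HasDerivAt (fun θ => -(Real.cos θ * Real.sin (x * Real.sin θ)))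
        (x * (Real.sin θ ^ 2 * Real.cos (x * Real.sin θ)) + Real.sin θ * Real.sin (x * Real.sin θ)
          - x * Real.cos (x * Real.sin θ)) θ := fun θ _ => by
    refine ((Real.hasDerivAt_cos θ).mul
      (((Real.hasDerivAt_sin θ).const_mul x).sin)).neg.congr_deriv ?_
    linear_combination x * Real.cos (x * Real.sin θ) * (-Real.sin_sq_add_cos_sq θ)
  have key := intervalIntegral.integral_eq_sub_of_hasDerivAt h
    (Continuous.intervalIntegrable (by fun_prop) _ _)
  rw [intervalIntegral.integral_sub (Continuous.intervalIntegrable (by fun_prop) _ _)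
      (Continuous.intervalIntegrable (by fun_prop) _ _),
    intervalIntegral.integral_add (Continuous.intervalIntegrable (by fun_prop) _ _)
      (Continuous.intervalIntegrable (by fun_prop) _ _),
    intervalIntegral.integral_const_mul, intervalIntegral.integral_const_mul] at key
  simp only [Real.sin_pi, Real.sin_zero, mul_zero, neg_zero, sub_zero] at key
  rw [(hasDerivAt_besselJ1 x).deriv, besselJ1_eq_integral_sin_mul_sin, besselJ0]
  linear_combination (1 / Real.pi) * key

theorem finite_hankel_J0_diagonal
    (R ξ : ℝ) (hR : 0 < R) (hξ : 0 < ξ) :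
    (∫ r in (0:ℝ)..R, besselJ0 (ξ * r) ^ 2 * r)
      = (R ^ 2 / 2) * (besselJ0 (R * ξ) ^ 2 + besselJ1 (R * ξ) ^ 2) := by
  have hcont : Continuous besselJ0 :=
    continuous_iff_continuousAt.2 fun x => (hasDerivAt_besselJ0 x).continuousAt
  have h : ∀ r ∈ Set.uIcc (0:ℝ) R,
      HasDerivAt (fun r => (r ^ 2 / 2) * (besselJ0 (r * ξ) ^ 2 + besselJ1 (r * ξ) ^ 2))
        (besselJ0 (ξ * r) ^ 2 * r) r := fun r _ => by
    have hlin : HasDerivAt (fun r : ℝ => r * ξ) ξ r := by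
      simpa using (hasDerivAt_id r).mul_const ξ
    have h0 := (hasDerivAt_besselJ0 (r * ξ)).comp r hlin
    have h1 := (hasDerivAt_besselJ1 (r * ξ)).differentiableAt.hasDerivAt.comp r hlin
    refine (((hasDerivAt_pow 2 r).div_const 2).mul
      ((h0.pow 2).add (h1.pow 2))).congr_deriv ?_
    simp only [Function.comp_apply, Pi.add_apply, Pi.pow_apply, mul_comm ξ r]
    push_cast
    linear_combination r * besselJ1 (r * ξ) * mul_deriv_besselJ1_add (r * ξ)
  rw [intervalIntegral.integral_eq_sub_of_hasDerivAt h
    (Continuous.intervalIntegrable (by fun_prop) _ _)]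
  simp
end
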